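/- Let φ : ℂ* → ℂ* be a conjugating mapping (a bijection such that for every holomorphic f : ℂ* → ℂ* the map φ ∘ f ∘ φ⁻¹ is holomorphic) with φ(1) = 1, and suppose there exists c ∈ ℂ* such that φ(exp(w)) = exp(c·φ(w)) for all w ∈ ℂ*. Then φ is continuous; in fact either φ(z) = z for all z ∈ ℂ*, or φ(z) = z̄ for all z ∈ ℂ*. -/

import Mathlib

open Complex Set

noncomputable section

noncomputable section

/-- The punctured complex line `ℂ* = ℂ ∖ {0}`. -/
def Cstar : Set ℂ := {z : ℂ | z ≠ 0}

/-- A holomorphic self-map of `ℂ*` (represented by a total function whose behaviour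
matters only on `ℂ*`). -/
def CstarEndo (f : ℂ → ℂ) : Prop :=
  DifferentiableOn ℂ f Cstar ∧ Set.MapsTo f Cstar Cstar

/-- A conjugating mapping of `ℂ*`: a bijection of `ℂ*` such that for every holomorphic
self-map `f` of `ℂ*` the conjugate `φ ∘ f ∘ φ⁻¹` is again a holomorphic self-map of `ℂ*`
(expressed as: there is a holomorphic self-map `g` with `g ∘ φ = φ ∘ f` on `ℂ*`). -/
def ConjugatingCstar (φ : ℂ → ℂ) : Prop :=
  Set.BijOn φ Cstar Cstar ∧
    ∀ f, CstarEndo f → ∃ g, CstarEndo g ∧ ∀ z ∈ Cstar, g (φ z) = φ (f z)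

open Filter Topology Metric

def PairC (g h : ℂ → ℂ) : Prop :=
  CstarEndo g ∧ CstarEndo h ∧ (∀ z, z ≠ 0 → h (g z) = z) ∧ (∀ z, z ≠ 0 → g (h z) = z)

lemma isOpen_Cstar : IsOpen Cstar := isOpen_ne

lemma CstarEndo.inv_left {g : ℂ → ℂ} (hg : CstarEndo g) : CstarEndo (fun z => (g z)⁻¹) :=
  ⟨hg.1.inv (fun z hz => hg.2 hz), fun z hz => inv_ne_zero (hg.2 hz)⟩

lemma CstarEndo_inv : CstarEndo (fun z : ℂ => z⁻¹) :=
  ⟨differentiableOn_id.inv (fun z hz => hz), fun z hz => inv_ne_zero hz⟩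

lemma CstarEndo.comp {f g : ℂ → ℂ} (hf : CstarEndo f) (hg : CstarEndo g) :
    CstarEndo (fun z => f (g z)) :=
  ⟨hf.1.comp hg.1 hg.2, fun z hz => hf.2 (hg.2 hz)⟩

lemma PairC.inv_left {g h : ℂ → ℂ} (H : PairC g h) : PairC (fun z => (g z)⁻¹) (fun z => h z⁻¹) := by
  obtain ⟨hg, hh, h1, h2⟩ := H
  refine ⟨hg.inv_left, hh.comp CstarEndo_inv, fun z hz => ?_, fun z hz => ?_⟩
  · simp [h1 z hz]
  · simp [h2 z⁻¹ (inv_ne_zero hz)]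

lemma PairC.symm {g h : ℂ → ℂ} (H : PairC g h) : PairC h g := ⟨H.2.1, H.1, H.2.2.2, H.2.2.1⟩

/-- bounded case near zero -/
lemma PairC.bigO_of_bdd {g h : ℂ → ℂ} (H : PairC g h) {r : ℝ} (hr : 0 < r)
    (hb : ∀ z, z ≠ 0 → ‖z‖ < r → ‖g z‖ < 1) :
    ∃ C : ℝ, ∀ᶠ z in 𝓝[≠] (0:ℂ), ‖g z‖ ≤ C * ‖z‖ := by
  obtain ⟨hg, hh, h1, h2⟩ := H
  have hd : DifferentiableOn ℂ (Function.update g 0 (limUnder (𝓝[≠] 0) g)) (ball 0 r) := by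
    apply Complex.differentiableOn_update_limUnder_of_bddAbove (ball_mem_nhds _ hr)
    · exact hg.1.mono (fun z hz => hz.2)
    · refine ⟨1, ?_⟩
      rintro _ ⟨z, hz, rfl⟩
      exact (hb z hz.2 (by simpa using hz.1)).le
  have hda := hd.differentiableAt (ball_mem_nhds _ hr)
  set L := limUnder (𝓝[≠] (0:ℂ)) g with hL
  have ht : Tendsto g (𝓝[≠] 0) (𝓝 L) := continuousAt_update_same.1 hda.continuousAt
  have hL0 : L = 0 := by
    by_contra hne
    have hc : ContinuousAt h L := (hh.1.differentiableAt (isOpen_Cstar.mem_nhds hne)).continuousAt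
    have t1 : Tendsto (fun z => h (g z)) (𝓝[≠] 0) (𝓝 (h L)) := hc.tendsto.comp ht
    have t2 : Tendsto (fun z => h (g z)) (𝓝[≠] 0) (𝓝 0) := by
      have : Tendsto (fun z : ℂ => z) (𝓝[≠] 0) (𝓝 0) := tendsto_id.mono_left nhdsWithin_le_nhds
      refine this.congr' ?_
      filter_upwards [self_mem_nhdsWithin] with z hz
      exact (h1 z hz).symm
    exact hh.2 hne (tendsto_nhds_unique t1 t2)
  rw [hL0] at hda
  obtain ⟨C, hC⟩ := hda.isBigO_sub.bound
  refine ⟨C, ?_⟩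
  filter_upwards [hC.filter_mono nhdsWithin_le_nhds, self_mem_nhdsWithin] with z hz hz0
  have : z ≠ 0 := hz0
  simpa [Function.update_of_ne this] using hz

lemma PairC.dichotomy {g h : ℂ → ℂ} (H : PairC g h) :
    (∃ C : ℝ, ∀ᶠ z in 𝓝[≠] (0:ℂ), ‖g z‖ ≤ C * ‖z‖) ∨
    (∃ C : ℝ, ∀ᶠ z in 𝓝[≠] (0:ℂ), ‖g z‖⁻¹ ≤ C * ‖z‖) := by
  obtain ⟨hg, hh, h1, h2⟩ := id H
  have hsub : sphere (0:ℂ) 1 ⊆ Cstar := fun z hz => by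
    rintro rfl
    simp at hz
  have hK : IsCompact (h '' sphere (0:ℂ) 1) :=
    (isCompact_sphere _ _).image_of_continuousOn (hh.1.continuousOn.mono hsub)
  have h0 : (0:ℂ) ∈ (h '' sphere (0:ℂ) 1)ᶜ := by
    rintro ⟨z, hz, hz0⟩
    exact hh.2 (hsub hz) hz0
  obtain ⟨r, hr, hball⟩ := Metric.isOpen_iff.1 hK.isClosed.isOpen_compl 0 h0
  have hne : ∀ z, z ≠ 0 → ‖z‖ < r → ‖g z‖ ≠ 1 := by
    intro z hz hzr he
    exact hball (by simpa using hzr) ⟨g z, by simpa using he, h1 z hz⟩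
  have hpre : IsPreconnected {w : ℂ | w.re < Real.log r} :=
    (convex_halfSpace_re_lt _).isPreconnected
  have hcont : ContinuousOn (fun w => ‖g (Complex.exp w)‖) {w : ℂ | w.re < Real.log r} := by
    refine ContinuousOn.norm (hg.1.continuousOn.comp Complex.continuous_exp.continuousOn ?_)
    intro w _
    exact Complex.exp_ne_zero w
  have key : ∀ z, z ≠ 0 → ‖z‖ < r → Complex.exp (Complex.log z) = z ∧ (Complex.log z).re < Real.log r := by
    intro z hz hzr
    refine ⟨Complex.exp_log hz, ?_⟩
    rw [Complex.log_re]
    exact Real.log_lt_log (norm_pos_iff.2 hz) hzr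
  by_cases hall : ∀ z, z ≠ 0 → ‖z‖ < r → ‖g z‖ < 1
  · exact Or.inl (H.bigO_of_bdd hr hall)
  · right
    push Not at hall
    obtain ⟨z0, hz0, hz0r, hz01⟩ := hall
    have := H.inv_left.bigO_of_bdd hr (by
      intro z hz hzr
      rw [norm_inv]
      apply inv_lt_one_of_one_lt₀
      by_contra hlt
      push Not at hlt
      obtain ⟨e1, l1⟩ := key z hz hzr
      obtain ⟨e0, l0⟩ := key z0 hz0 hz0r
      obtain ⟨w, hw, hw1⟩ := hpre.intermediate_value l1 l0 hcont
        (show (1:ℝ) ∈ _ from ⟨by simpa [e1] using hlt, by simpa [e0] using hz01⟩)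
      refine hne _ (Complex.exp_ne_zero w) ?_ hw1
      rw [Complex.norm_exp]
      exact (Real.lt_log_iff_exp_lt hr).1 hw)
    simpa only [norm_inv] using this

lemma liouville_Cstar {p : ℂ → ℂ} (hp : DifferentiableOn ℂ p Cstar) {M : ℝ}
    (hM : ∀ z, z ≠ 0 → ‖p z‖ ≤ M) : ∀ z, z ≠ 0 → p z = p 1 := by
  have hd : DifferentiableOn ℂ (Function.update p 0 (limUnder (𝓝[≠] 0) p)) univ := by
    apply Complex.differentiableOn_update_limUnder_of_bddAbove univ_mem
    · exact hp.mono (fun z hz => hz.2)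
    · refine ⟨M, ?_⟩
      rintro _ ⟨z, hz, rfl⟩
      exact hM z hz.2
  intro z hz
  have := Differentiable.apply_eq_apply_of_bounded (differentiableOn_univ.1 hd) (by
    rw [isBounded_iff_forall_norm_le]
    refine ⟨max M ‖limUnder (𝓝[≠] 0) p‖, ?_⟩
    rintro _ ⟨z, rfl⟩
    by_cases hz : z = 0
    · subst hz; simp
    · rw [Function.update_of_ne hz]; exact le_max_of_le_left (hM z hz)) z 1
  simpa [Function.update_of_ne hz] using this

lemma not_ev_inv_le {D : ℝ} : ¬ ∀ᶠ z in 𝓝[≠] (0:ℂ), ‖z‖⁻¹ ≤ D * ‖z‖ := by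
  intro h
  have h2 : Tendsto (fun z : ℂ => D * ‖z‖ * ‖z‖) (𝓝[≠] 0) (𝓝 0) := by
    have : Continuous (fun z : ℂ => D * ‖z‖ * ‖z‖) := by fun_prop
    have := (this.tendsto 0).mono_left (nhdsWithin_le_nhds (s := {0}ᶜ))
    simpa using this
  have h3 := h2.eventually_lt_const (zero_lt_one)
  obtain ⟨z, ⟨hz1, hz2⟩, hz0⟩ := ((h.and h3).and self_mem_nhdsWithin).exists
  have hp : 0 < ‖z‖ := norm_pos_iff.2 hz0
  have := mul_le_mul_of_nonneg_right hz1 hp.le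
  rw [inv_mul_cancel₀ hp.ne'] at this
  linarith

lemma PairC.linear_of_bigO {g h : ℂ → ℂ} (H : PairC g h)
    (hO : ∃ C : ℝ, ∀ᶠ z in 𝓝[≠] (0:ℂ), ‖g z‖ ≤ C * ‖z‖) :
    ∀ z, z ≠ 0 → g z = g 1 * z := by
  obtain ⟨hg, hh, h1, h2⟩ := id H
  obtain ⟨C, hC⟩ := hO
  have hgt : Tendsto g (𝓝[≠] 0) (𝓝[≠] 0) := by
    rw [tendsto_nhdsWithin_iff]
    constructor
    · refine squeeze_zero_norm' hC ?_
      have : Continuous (fun z : ℂ => C * ‖z‖) := by fun_prop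
      have := (this.tendsto 0).mono_left (nhdsWithin_le_nhds (s := {0}ᶜ))
      simpa using this
    · filter_upwards [self_mem_nhdsWithin] with z hz using hg.2 hz
  have hlow : ∃ C' : ℝ, 0 < C' ∧ ∀ᶠ z in 𝓝[≠] (0:ℂ), ‖h z‖ ≤ C' * ‖z‖ := by
    rcases H.symm.dichotomy with ⟨C', hC'⟩ | ⟨C', hC'⟩
    · refine ⟨max C' 1, by positivity, ?_⟩
      filter_upwards [hC'] with z hz
      exact hz.trans (mul_le_mul_of_nonneg_right (le_max_left _ _) (norm_nonneg _))
    · exfalso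
      refine not_ev_inv_le (D := max C' 0 * C) ?_
      filter_upwards [hgt.eventually hC', hC, self_mem_nhdsWithin] with z hz hz2 hz0
      rw [h1 z hz0] at hz
      calc _ ≤ C' * ‖g z‖ := hz
        _ ≤ max C' 0 * ‖g z‖ := mul_le_mul_of_nonneg_right (le_max_left _ _) (norm_nonneg _)
        _ ≤ max C' 0 * (C * ‖z‖) := mul_le_mul_of_nonneg_left hz2 (le_max_right _ _)
        _ = _ := by ring
  obtain ⟨C', hC'0, hC'⟩ := hlow
  have hlow : ∀ᶠ z in 𝓝[≠] (0:ℂ), ‖z‖ ≤ C' * ‖g z‖ := by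
    filter_upwards [hgt.eventually hC', self_mem_nhdsWithin] with z hz hz0
    rwa [h1 z hz0] at hz
  have HK : PairC (fun z => (g z⁻¹)⁻¹) (fun z => (h z⁻¹)⁻¹) :=
    H.inv_left.symm.inv_left.symm
  have hhi : ∃ C'' : ℝ, ∀ᶠ z in 𝓝[≠] (0:ℂ), ‖g z⁻¹‖⁻¹ ≤ C'' * ‖z‖ := by
    rcases HK.dichotomy with ⟨C'', hC''⟩ | ⟨C'', hC''⟩
    · simp only [norm_inv] at hC''
      exact ⟨C'', hC''⟩
    · exfalso
      simp only [norm_inv, inv_inv] at hC''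
      have hgt' : Tendsto (fun z => g z⁻¹) (𝓝[≠] 0) (𝓝[≠] 0) := by
        rw [tendsto_nhdsWithin_iff]
        constructor
        · refine squeeze_zero_norm' hC'' ?_
          have : Continuous (fun z : ℂ => C'' * ‖z‖) := by fun_prop
          have := (this.tendsto 0).mono_left (nhdsWithin_le_nhds (s := {0}ᶜ))
          simpa using this
        · filter_upwards [self_mem_nhdsWithin] with z hz using hg.2 (inv_ne_zero hz)
      refine not_ev_inv_le (D := C' * C'') ?_
      filter_upwards [hgt'.eventually hC', hC'', self_mem_nhdsWithin] with z hz hz2 hz0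
      rw [h1 _ (inv_ne_zero hz0), norm_inv] at hz
      calc _ ≤ C' * ‖g z⁻¹‖ := hz
        _ ≤ C' * (C'' * ‖z‖) := mul_le_mul_of_nonneg_left hz2 hC'0.le
        _ = _ := by ring
  obtain ⟨C'', hC''⟩ := hhi
  have hpd : DifferentiableOn ℂ (fun z => z / g z) Cstar :=
    differentiableOn_id.div hg.1 (fun z hz => hg.2 hz)
  obtain ⟨r, hr, hr'⟩ := Metric.mem_nhdsWithin_iff.1 hlow
  obtain ⟨s, hs, hs'⟩ := Metric.mem_nhdsWithin_iff.1 hC''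
  have hcomp : IsCompact {z : ℂ | r ≤ ‖z‖ ∧ ‖z‖ ≤ s⁻¹} := by
    refine (isCompact_closedBall (0:ℂ) s⁻¹).of_isClosed_subset ?_ ?_
    · exact (isClosed_le continuous_const continuous_norm).inter
        (isClosed_le continuous_norm continuous_const)
    · intro z hz; simpa using hz.2
  obtain ⟨M, hM⟩ := hcomp.exists_bound_of_continuousOn (f := fun z => z / g z)
    (hpd.continuousOn.mono (fun z hz => by
      have := hr.trans_le hz.1
      exact norm_pos_iff.1 this))
  have hconst := liouville_Cstar hpd (M := max M (max C' C'')) (by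
    intro z hz
    have hzp : 0 < ‖z‖ := norm_pos_iff.2 hz
    have hgp : 0 < ‖g z‖ := norm_pos_iff.2 (hg.2 hz)
    by_cases c1 : ‖z‖ < r
    · have : ‖z‖ ≤ C' * ‖g z‖ := hr' ⟨by simpa using c1, hz⟩
      refine le_max_of_le_right (le_max_of_le_left ?_)
      rw [norm_div, div_le_iff₀ hgp]; exact this
    by_cases c2 : ‖z‖ ≤ s⁻¹
    · exact le_max_of_le_left (hM z ⟨not_lt.1 c1, c2⟩)
    · have c3 : ‖z⁻¹‖ < s := by
        rw [norm_inv]; exact inv_lt_of_inv_lt₀ hs (not_le.1 c2)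
      have : ‖g z⁻¹⁻¹‖⁻¹ ≤ C'' * ‖z⁻¹‖ := hs' ⟨by simpa using c3, inv_ne_zero hz⟩
      rw [inv_inv, norm_inv] at this
      refine le_max_of_le_right (le_max_of_le_right ?_)
      rw [norm_div, div_eq_mul_inv]
      calc _ ≤ ‖z‖ * (C'' * ‖z‖⁻¹) := mul_le_mul_of_nonneg_left this hzp.le
        _ = C'' := by field_simp)
  intro z hz
  have := hconst z hz
  have a1 : g z ≠ 0 := hg.2 hz
  have a2 : g 1 ≠ 0 := hg.2 (one_ne_zero : (1:ℂ) ≠ 0)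
  field_simp at this
  rw [← this]; ring

lemma PairC.classify {g h : ℂ → ℂ} (H : PairC g h) :
    (∀ z, z ≠ 0 → g z = g 1 * z) ∨ (∀ z, z ≠ 0 → g z = g 1 / z) := by
  rcases H.dichotomy with h | h
  · exact Or.inl (H.linear_of_bigO h)
  · right
    intro z hz
    have := H.inv_left.linear_of_bigO (by simpa only [norm_inv] using h) z hz
    rw [← inv_inv (g z), this, mul_inv, inv_inv]; rfl

lemma conj_pair {φ : ℂ → ℂ} (hφ : ConjugatingCstar φ) {b : ℂ} (hb : b ≠ 0) :
    ∃ g h, PairC g h ∧ ∀ z, z ≠ 0 → g (φ z) = φ (b * z) := by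
  have endo : ∀ b : ℂ, b ≠ 0 → CstarEndo (fun z => b * z) := fun b hb =>
    ⟨(differentiableOn_id.const_mul b), fun z hz => mul_ne_zero hb hz⟩
  obtain ⟨g, hg, hg'⟩ := hφ.2 _ (endo b hb)
  obtain ⟨h, hh, hh'⟩ := hφ.2 _ (endo b⁻¹ (inv_ne_zero hb))
  refine ⟨g, h, ⟨hg, hh, ?_, ?_⟩, hg'⟩
  · intro z hz
    obtain ⟨w, hw, rfl⟩ := hφ.1.surjOn hz
    rw [hg' w hw, hh' _ (mul_ne_zero hb hw), inv_mul_cancel_left₀ hb]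
  · intro z hz
    obtain ⟨w, hw, rfl⟩ := hφ.1.surjOn hz
    rw [hh' w hw, hg' _ (mul_ne_zero (inv_ne_zero hb) hw), mul_inv_cancel_left₀ hb]

lemma cstar_conj_mul {φ : ℂ → ℂ} (hφ : ConjugatingCstar φ) (h1 : φ 1 = 1) {a z : ℂ} (ha : a ≠ 0)
    (hz : z ≠ 0) : φ (a * z) = φ a * φ z := by
  obtain ⟨b, hb⟩ := IsAlgClosed.exists_eq_mul_self a
  have hb0 : b ≠ 0 := by rintro rfl; simp at hb; exact ha hb
  obtain ⟨g, h, H, hg⟩ := conj_pair hφ hb0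
  have hgg : ∀ z, z ≠ 0 → g (g (φ z)) = φ (a * z) := by
    intro z hz
    rw [hg z hz, hg _ (mul_ne_zero hb0 hz), hb, mul_assoc]
  have hφ0 : ∀ z, z ≠ 0 → φ z ≠ 0 := fun z hz => hφ.1.mapsTo hz
  have e1 := hgg 1 one_ne_zero
  have e2 := hgg z hz
  rw [mul_one, h1] at e1
  have g1 : g 1 ≠ 0 := H.1.2 (one_ne_zero : (1:ℂ) ≠ 0)
  rw [← e1, ← e2]
  rcases H.classify with hl | hl
  · rw [hl _ (H.1.2 (hφ0 z hz)), hl _ (hφ0 z hz), hl _ g1]; ring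
  · rw [hl _ (H.1.2 (hφ0 z hz)), hl _ (hφ0 z hz), hl _ g1]
    have := hφ0 z hz
    field_simp

lemma exists_ringHom {φ : ℂ → ℂ} (hφ : ConjugatingCstar φ) (h1 : φ 1 = 1)
    (c : ℂ) (hc : c ≠ 0)
    (hexp : ∀ w ∈ Cstar, φ (Complex.exp w) = Complex.exp (c * φ w)) :
    ∃ ψ : ℂ →+* ℂ, ∀ z, z ≠ 0 → ψ z = φ z := by
  have hφ0 : ∀ z, z ≠ 0 → φ z ≠ 0 := fun z hz => hφ.1.mapsTo hz
  have hm : ∀ a z, a ≠ 0 → z ≠ 0 → φ (a * z) = φ a * φ z := fun a z ha hz => cstar_conj_mul hφ h1 ha hz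
  have hneg1 : φ (-1) = -1 := by
    have h2 : φ (-1) * φ (-1) = 1 := by rw [← hm _ _ (by simp) (by simp)]; simpa using h1
    rcases mul_self_eq_one_iff.1 h2 with h | h
    · exfalso
      have := hφ.1.injOn (show (-1:ℂ) ∈ Cstar by simp [Cstar]) (show (1:ℂ) ∈ Cstar by simp [Cstar])
        (h.trans h1.symm)
      norm_num at this
    · exact h
  have hneg : ∀ z, z ≠ 0 → φ (-z) = - φ z := by
    intro z hz
    have := hm (-1) z (by simp) hz
    rw [hneg1] at this
    simpa using this
  have hadd : ∀ a b, a ≠ 0 → b ≠ 0 → a + b ≠ 0 → φ (a + b) = φ a + φ b := by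
    intro a b ha hb hab
    by_contra hne
    set d := φ (a + b) - (φ a + φ b) with hd
    have hd0 : d ≠ 0 := sub_ne_zero.2 hne
    have key : ∀ s : ℂ, s ≠ 0 → Complex.exp (c * (s * d)) = 1 := by
      intro s hs
      obtain ⟨t, ht, rfl⟩ := hφ.1.surjOn hs
      have e : c * (φ t * d) = c * φ (t * (a + b)) - (c * φ (t * a) + c * φ (t * b)) := by
        rw [hm t _ ht hab, hm t _ ht ha, hm t _ ht hb, hd]; ring
      rw [e, Complex.exp_sub, Complex.exp_add, ← hexp _ (mul_ne_zero ht hab),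
        ← hexp _ (mul_ne_zero ht ha), ← hexp _ (mul_ne_zero ht hb),
        ← hm _ _ (Complex.exp_ne_zero _) (Complex.exp_ne_zero _), ← Complex.exp_add, ← mul_add]
      exact div_self (hφ0 _ (Complex.exp_ne_zero _))
    have := key (1 / (c * d)) (by simp [hc, hd0])
    rw [show c * (1 / (c * d) * d) = ((1:ℝ):ℂ) by push_cast; field_simp] at this
    rw [← Complex.ofReal_exp] at this
    have h3 : Real.exp 1 = 1 := by exact_mod_cast this
    simp at h3
  refine ⟨{ toFun := fun z => if z = 0 then 0 else φ z, map_zero' := by simp, map_one' := by simp [h1], map_mul' := ?_, map_add' := ?_ }, ?_⟩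
  · intro x y
    by_cases hx : x = 0
    · simp [hx]
    by_cases hy : y = 0
    · simp [hy]
    simp [hx, hy, hm x y hx hy]
  · intro x y
    by_cases hx : x = 0
    · simp [hx]
    by_cases hy : y = 0
    · simp [hy]
    by_cases hxy : x + y = 0
    · have : y = -x := by linear_combination hxy
      subst this
      simp [hx, hneg x hx]
    simp [hx, hy, hxy, hadd x y hx hy hxy]
  · intro z hz
    simp [hz]

lemma exists_entire (z : ℕ → ℂ) (hz : Function.Injective z) (hzb : ∀ k, ‖z k‖ ≤ 2)
    (P : ℕ → ℂ → Prop) (hP : ∀ k v, ∀ ε > 0, ∃ u, ‖u - v‖ < ε ∧ P k u) :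
    ∃ h : ℂ → ℂ, Differentiable ℂ h ∧ ∀ k, P k (h (z k)) := by
  let B : ℕ → ℂ → ℂ := fun k w => ∏ j ∈ Finset.range k, (w - z j)
  have hB : ∀ k, B k (z k) ≠ 0 := fun k => Finset.prod_ne_zero_iff.2 (fun j hj => by
    rw [sub_ne_zero]; intro h; have := hz h; simp at hj; omega)
  have hB0 : ∀ k j, k < j → B j (z k) = 0 := fun k j hkj =>
    Finset.prod_eq_zero (Finset.mem_range.2 hkj) (sub_self _)
  have hBn : ∀ k w, ‖B k w‖ ≤ (‖w‖ + 2) ^ k := by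
    intro k w
    simp only [B, norm_prod]
    calc _ ≤ ∏ j ∈ Finset.range k, (‖w‖ + 2) := Finset.prod_le_prod (fun _ _ => norm_nonneg _)
          (fun j _ => (norm_sub_le _ _).trans (by linarith [hzb j]))
      _ = _ := by simp
  have hA : ∀ k s, ∃ a : ℂ, ‖a‖ ≤ 1 / (k.factorial : ℝ) ∧ P k (s + a * B k (z k)) := by
    intro k s
    have hp : 0 < ‖B k (z k)‖ := norm_pos_iff.2 (hB k)
    obtain ⟨u, hu, hPu⟩ := hP k s (1 / (k.factorial : ℝ) * ‖B k (z k)‖) (by positivity)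
    refine ⟨(u - s) / B k (z k), ?_, ?_⟩
    · rw [norm_div, div_le_iff₀ hp]; exact hu.le
    · rw [div_mul_cancel₀ _ (hB k)]; simpa using hPu
  choose A hA1 hA2 using hA
  let Q : ℕ → ℂ → ℂ := fun n => Nat.rec (fun _ => 0) (fun k q w => q w + A k (q (z k)) * B k w) n
  let a : ℕ → ℂ := fun k => A k (Q k (z k))
  have hQ : ∀ k w, Q k w = ∑ j ∈ Finset.range k, a j * B j w := by
    intro k w
    induction k with
    | zero => rfl
    | succ k ih => rw [Finset.sum_range_succ, ← ih]
  refine ⟨fun w => ∑' j, a j * B j w, ?_, ?_⟩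
  · intro w
    have := Complex.differentiableOn_tsum_of_summable_norm (F := fun j w => a j * B j w)
      (U := ball 0 (‖w‖ + 1)) (Real.summable_pow_div_factorial (‖w‖ + 1 + 2)) ?_ isOpen_ball ?_
    · exact this.differentiableAt (isOpen_ball.mem_nhds (by simp))
    · intro i
      simp only [B]
      fun_prop
    · intro i v hv
      have hv' : ‖v‖ < ‖w‖ + 1 := by simpa using hv
      rw [norm_mul]
      calc _ ≤ 1 / (i.factorial : ℝ) * (‖v‖ + 2) ^ i :=
            mul_le_mul (hA1 _ _) (hBn _ _) (norm_nonneg _) (by positivity)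
        _ ≤ 1 / (i.factorial : ℝ) * (‖w‖ + 1 + 2) ^ i := by gcongr
        _ = _ := by ring
  · intro k
    have : ∑' j, a j * B j (z k) = Q k (z k) + a k * B k (z k) := by
      rw [tsum_eq_sum (s := Finset.range (k+1)), Finset.sum_range_succ, hQ]
      intro j hj
      rw [hB0 k j (by simpa using hj), mul_zero]
    simp only [this]
    exact hA2 _ _

/-- a conjugating mapping `φ` of `ℂ*` with `φ(1) = 1` that conjugates
`exp` to `z ↦ exp(c z)` is continuous; in fact it is the identity or complex conjugation. -/
theorem stmt5 (φ : ℂ → ℂ) (hφ : ConjugatingCstar φ) (h1 : φ 1 = 1)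
    (c : ℂ) (hc : c ≠ 0)
    (hexp : ∀ w ∈ Cstar, φ (Complex.exp w) = Complex.exp (c * φ w)) :
    ContinuousOn φ Cstar ∧
      ((∀ z ∈ Cstar, φ z = z) ∨ (∀ z ∈ Cstar, φ z = starRingEnd ℂ z)) := by
  obtain ⟨ψ, hψ⟩ := exists_ringHom hφ h1 c hc hexp
  have hexp' : ∀ w, φ (Complex.exp w) = Complex.exp (c * ψ w) := by
    intro w
    by_cases hw : w = 0
    · simp [hw, h1]
    · rw [hψ w hw]; exact hexp w hw
  have hbdd : ∃ (M : ℝ) (v : ℂ) (ε : ℝ), 0 < ε ∧ ∀ u, ‖u - v‖ < ε → (c * ψ u).re ≤ M := by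
    by_contra hcon
    push Not at hcon
    let z : ℕ → ℂ := fun k => 1 + 1 / ((k : ℂ) + 1)
    have hz0 : ∀ k, z k ≠ 0 := by
      intro k hk
      have : (z k).re = 0 := by rw [hk]; rfl
      have e : z k = ((1 + 1 / ((k:ℝ) + 1) : ℝ) : ℂ) := by simp [z]
      rw [e, Complex.ofReal_re] at this
      have : (0:ℝ) < 1 + 1 / ((k:ℝ) + 1) := by positivity
      linarith
    have hzφ : ∀ k, φ (z k) = z k := by
      intro k
      rw [← hψ _ (hz0 k)]; simp [z]
    have hzt : Tendsto z atTop (𝓝 1) := by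
      have := (tendsto_one_div_add_atTop_nhds_zero_nat (𝕜 := ℂ)).const_add 1
      simpa [z] using this
    obtain ⟨h, hd, hP⟩ := exists_entire z (by
        intro i j hij
        simp only [z, add_right_inj, one_div, inv_inj, add_left_inj] at hij
        exact_mod_cast hij) (by
        intro k
        have e : ‖1 / ((k : ℂ) + 1)‖ ≤ 1 := by
          rw [norm_div, norm_one]
          have : ‖(k:ℂ) + 1‖ = (k:ℝ) + 1 := by
            rw [← Nat.cast_succ, Complex.norm_natCast]; simp
          rw [this, div_le_one (by positivity)]
          simp
        calc _ ≤ ‖(1:ℂ)‖ + ‖1 / ((k : ℂ) + 1)‖ := norm_add_le _ _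
          _ ≤ 2 := by rw [norm_one]; linarith)
      (fun k u => (k : ℝ) < (c * ψ u).re) (fun k v ε hε => hcon k v ε hε)
    obtain ⟨g, hg, hg'⟩ := hφ.2 (fun w => Complex.exp (h w))
      ⟨hd.cexp.differentiableOn, fun w _ => Complex.exp_ne_zero _⟩
    have hgc : ContinuousAt g 1 :=
      (hg.1.differentiableAt (isOpen_Cstar.mem_nhds (one_ne_zero : (1:ℂ) ≠ 0))).continuousAt
    have ht : Tendsto (fun k => ‖g (z k)‖) atTop (𝓝 ‖g 1‖) := (hgc.tendsto.comp hzt).norm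
    refine not_tendsto_nhds_of_tendsto_atTop ?_ _ ht
    refine tendsto_atTop_mono ?_ tendsto_natCast_atTop_atTop
    intro k
    have e := hg' (z k) (hz0 k)
    rw [hzφ, hexp'] at e
    rw [e, Complex.norm_exp]
    linarith [hP k, Real.add_one_le_exp (c * ψ (h (z k))).re]
  obtain ⟨M, v, ε, hε, hM⟩ := hbdd
  set M' := M - (c * ψ v).re with hM'
  have b1 : ∀ u, ‖u‖ < ε → (c * ψ u).re ≤ M' := by
    intro u hu
    have := hM (u + v) (by simpa using hu)
    rw [map_add, mul_add, Complex.add_re] at this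
    linarith
  have b2 : ∀ u, ‖u‖ < ε → |(c * ψ u).re| ≤ M' := by
    intro u hu
    have := b1 (-u) (by simpa using hu)
    rw [map_neg, mul_neg, Complex.neg_re] at this
    exact abs_le.2 ⟨by linarith, b1 u hu⟩
  have hI : ψ I = I ∨ ψ I = -I := by
    have : ψ I * ψ I = I * I := by rw [← map_mul]; simp
    exact mul_self_eq_mul_self_iff.1 this
  have b3 : ∀ u, ‖u‖ < ε → |(c * ψ u).im| ≤ M' := by
    intro u hu
    have := b2 (I * u) (by simpa using hu)
    rw [map_mul, mul_left_comm] at this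
    rcases hI with h | h
    · rw [h] at this; simpa only [Complex.I_mul_re, abs_neg] using this
    · rw [h] at this
      simpa only [neg_mul, Complex.neg_re, Complex.I_mul_re, neg_neg] using this
  have hcont : Continuous ψ := by
    refine AddMonoidHom.continuous_of_isBounded_nhds_zero (ψ : ℂ →+ ℂ) (ball_mem_nhds 0 hε) ?_
    rw [isBounded_iff_forall_norm_le]
    refine ⟨(M' + M') / ‖c‖, ?_⟩
    rintro _ ⟨u, hu, rfl⟩
    have hu' : ‖u‖ < ε := by simpa using hu
    rw [le_div_iff₀ (norm_pos_iff.2 hc), mul_comm]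
    change ‖c‖ * ‖ψ u‖ ≤ _
    rw [← norm_mul]
    exact (Complex.norm_le_abs_re_add_abs_im _).trans (add_le_add (b2 u hu') (b3 u hu'))
  refine ⟨hcont.continuousOn.congr (fun z hz => (hψ z hz).symm), ?_⟩
  rcases ringHom_eq_id_or_conj_of_continuous hcont with h | h
  · left; intro z hz; rw [← hψ z hz, h]; rfl
  · right; intro z hz; rw [← hψ z hz, h]
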